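/- arXiv:1507.06161 — 3 statements merged into one kernel-verified Lean document; each statement's English description precedes it below -/
import Mathlib

section
/- Let g, h : ℝⁿ → ℝ be twice continuously differentiable on an open set U ⊆ ℝⁿ and let B ⊆ U. Let L_g and L_h be proper subsets of {1,…,n} with L_g ∪ L_h = {1,…,n}, such that g depends at most linearly on x_i for all i ∈ L_g and h depends at most linearly on x_i for all i ∈ L_h. Suppose every eigenvalue of ∇²_{L_gᶜ} g(x) lies in [λ̲_g, λ̄_g] and every eigenvalue of ∇²_{L_hᶜ} h(x) lies in [λ̲_h, λ̄_h], for every x ∈ B. Then, with L_f = L_g ∩ L_h, for every x ∈ B every eigenvalue of the reduced Hessian ∇²_{L_fᶜ}(g+h)(x) lies in the interval [min{λ̲_g, λ̲_h}, max{λ̄_g, λ̄_h}]. -/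
open scoped BigOperators

/-- First partial derivative `∂f/∂x_i (x)`. -/
noncomputable def pd {n : ℕ} (f : (Fin n → ℝ) → ℝ) (i : Fin n) (x : Fin n → ℝ) : ℝ :=
  fderiv ℝ f x (Pi.single i 1)

/-- Second partial derivative `∂²f/∂x_i∂x_j (x)` (differentiate w.r.t. `x_j` first, then `x_i`). -/
noncomputable def pd2 {n : ℕ} (f : (Fin n → ℝ) → ℝ) (i j : Fin n) (x : Fin n → ℝ) : ℝ :=
  pd (fun y => pd f j y) i x

/-- Hessian matrix `∇²f(x)` with entries `(∇²f(x))_{ij} = ∂²f/∂x_i∂x_j (x)`. -/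
noncomputable def hess {n : ℕ} (f : (Fin n → ℝ) → ℝ) (x : Fin n → ℝ) :
    Matrix (Fin n) (Fin n) ℝ :=
  Matrix.of fun i j => pd2 f i j x

/-- Reduced Hessian `∇²_J f(x)` indexed by the elements of `J` in ascending order. -/
noncomputable def redHess {n : ℕ} (f : (Fin n → ℝ) → ℝ) (J : Finset (Fin n)) (x : Fin n → ℝ) :
    Matrix (Fin J.card) (Fin J.card) ℝ :=
  Matrix.of fun i j => pd2 f (J.orderIsoOfFin rfl i).1 (J.orderIsoOfFin rfl j).1 x

/-- Every eigenvalue of the (symmetric) matrix `M` lies in `[lo, hi]`. -/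
def eigsIn {m : ℕ} (M : Matrix (Fin m) (Fin m) ℝ) (lo hi : ℝ) : Prop :=
  ∀ (μ : ℝ) (v : Fin m → ℝ), v ≠ 0 → M.mulVec v = μ • v → lo ≤ μ ∧ μ ≤ hi

/-- A sum over `J` expressed through the ascending enumeration of `J`. -/
theorem sum_orderIsoOfFin {n : ℕ} (J : Finset (Fin n)) (F : Fin n → ℝ) :
    ∑ k, F (J.orderIsoOfFin rfl k).1 = ∑ j ∈ J, F j := by
  rw [← Finset.sum_coe_sort J F]
  exact Equiv.sum_comp (J.orderIsoOfFin rfl).toEquiv (fun j : J => F j)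

/-- Eigenvalue bounds of a reduced Hessian in terms of vectors indexed by all coordinates. -/
theorem eigsIn_redHess_iff {n : ℕ} (f : (Fin n → ℝ) → ℝ) (J : Finset (Fin n)) (x : Fin n → ℝ)
    (lo hi : ℝ) :
    eigsIn (redHess f J x) lo hi ↔
      ∀ (μ : ℝ) (v : Fin n → ℝ), (∃ i ∈ J, v i ≠ 0) →
        (∀ i ∈ J, ∑ j ∈ J, pd2 f i j x * v j = μ * v i) → lo ≤ μ ∧ μ ≤ hi := by
  constructor
  · rintro H μ v ⟨i, hi, hvi⟩ hv
    refine H μ (fun k => v (J.orderIsoOfFin rfl k).1) (fun h0 => hvi ?_) ?_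
    · simpa using congrFun h0 ((J.orderIsoOfFin rfl).symm ⟨i, hi⟩)
    · funext k
      have := hv _ (J.orderIsoOfFin rfl k).2
      rw [← sum_orderIsoOfFin] at this
      exact this
  · intro H μ v hv0 hv
    obtain ⟨k, hk⟩ := Function.ne_iff.1 hv0
    let w : Fin n → ℝ := fun i => if hi : i ∈ J then v ((J.orderIsoOfFin rfl).symm ⟨i, hi⟩) else 0
    have hw : ∀ k, w (J.orderIsoOfFin rfl k).1 = v k := fun k => by
      have : (J.orderIsoOfFin rfl k).1 ∈ J := (J.orderIsoOfFin rfl k).2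
      simp only [w, dif_pos this, Subtype.coe_eta, OrderIso.symm_apply_apply]
    refine H μ w ⟨_, (J.orderIsoOfFin rfl k).2, by rw [hw]; exact hk⟩ fun i hi => ?_
    obtain ⟨l, hl⟩ := (J.orderIsoOfFin rfl).surjective ⟨i, hi⟩
    obtain rfl : (J.orderIsoOfFin rfl l).1 = i := congrArg Subtype.val hl
    rw [← sum_orderIsoOfFin, hw]
    simp only [hw]
    exact congrFun hv l

theorem ContDiffAt.differentiableAt_fderiv_of_two {n : ℕ} {f : (Fin n → ℝ) → ℝ} {x : Fin n → ℝ}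
    (hf : ContDiffAt ℝ 2 f x) : DifferentiableAt ℝ (fderiv ℝ f) x :=
  (hf.fderiv_right (m := 1) (by norm_num)).differentiableAt (by norm_num)

theorem ContDiffAt.differentiableAt_pd {n : ℕ} {f : (Fin n → ℝ) → ℝ} {x : Fin n → ℝ}
    (hf : ContDiffAt ℝ 2 f x) (j : Fin n) : DifferentiableAt ℝ (fun y => pd f j y) x :=
  hf.differentiableAt_fderiv_of_two.clm_apply (differentiableAt_const _)

theorem ContDiffAt.pd2_eq {n : ℕ} {f : (Fin n → ℝ) → ℝ} {x : Fin n → ℝ}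
    (hf : ContDiffAt ℝ 2 f x) (i j : Fin n) :
    pd2 f i j x = fderiv ℝ (fderiv ℝ f) x (Pi.single i 1) (Pi.single j 1) := by
  unfold pd2 pd
  rw [fderiv_clm_apply hf.differentiableAt_fderiv_of_two (differentiableAt_const _)]
  simp

theorem ContDiffAt.pd2_comm {n : ℕ} {f : (Fin n → ℝ) → ℝ} {x : Fin n → ℝ}
    (hf : ContDiffAt ℝ 2 f x) (i j : Fin n) : pd2 f i j x = pd2 f j i x := by
  rw [hf.pd2_eq, hf.pd2_eq]
  exact (hf.isSymmSndFDerivAt (by simp)).eq _ _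

theorem ContDiffAt.pd2_add {n : ℕ} {f g : (Fin n → ℝ) → ℝ} {x : Fin n → ℝ}
    (hf : ContDiffAt ℝ 2 f x) (hg : ContDiffAt ℝ 2 g x) (i j : Fin n) :
    pd2 (fun y => f y + g y) i j x = pd2 f i j x + pd2 g i j x := by
  have key : (fun y => pd (fun y => f y + g y) j y) =ᶠ[nhds x] fun y => pd f j y + pd g j y := by
    filter_upwards [hf.eventually (by simp), hg.eventually (by simp)] with y hfy hgy
    simp only [pd]
    rw [fderiv_fun_add (hfy.differentiableAt (by norm_num)) (hgy.differentiableAt (by norm_num))]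
    rfl
  unfold pd2
  rw [pd, key.fderiv_eq, fderiv_fun_add (hf.differentiableAt_pd j) (hg.differentiableAt_pd j)]
  rfl

/-- Second partial derivatives in a variable on which `f` depends at most linearly vanish. -/
theorem pd2_eq_zero_of_pd_const {n : ℕ} {f : (Fin n → ℝ) → ℝ} {U : Set (Fin n → ℝ)}
    {x : Fin n → ℝ} (hU : U ∈ nhds x) {j : Fin n} (hj : ∃ c : ℝ, ∀ y ∈ U, pd f j y = c)
    (i : Fin n) : pd2 f i j x = 0 := by
  obtain ⟨c, hc⟩ := hj
  have key : (fun y => pd f j y) =ᶠ[nhds x] fun _ => c := by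
    filter_upwards [hU] with y hy using hc y hy
  unfold pd2
  rw [pd, key.fderiv_eq]
  simp

/-- If the Hessian of `f` on `K` restricts to the Hessian of `p` on `J ⊆ K`, decoupled from
the remaining coordinates, then an eigenvector not vanishing on `J` has its eigenvalue bounded. -/
theorem eigenvalue_bounds_of_decoupled {n : ℕ} {p f : (Fin n → ℝ) → ℝ} {J K : Finset (Fin n)}
    {x : Fin n → ℝ} {lo hi μ : ℝ} {v : Fin n → ℝ} (hJK : J ⊆ K)
    (hJ : ∀ i ∈ J, ∀ j ∈ J, pd2 f i j x = pd2 p i j x)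
    (hK : ∀ i ∈ J, ∀ j ∈ K, j ∉ J → pd2 f i j x = 0)
    (hp : eigsIn (redHess p J x) lo hi) (hv : ∃ i ∈ J, v i ≠ 0)
    (hf : ∀ i ∈ K, ∑ j ∈ K, pd2 f i j x * v j = μ * v i) : lo ≤ μ ∧ μ ≤ hi := by
  refine (eigsIn_redHess_iff p J x lo hi).1 hp μ v hv fun i hi => ?_
  rw [← hf i (hJK hi), ← Finset.sum_subset hJK fun j hj hjJ => by rw [hK i hi j hj hjJ, zero_mul]]
  exact Finset.sum_congr rfl fun j hj => by rw [hJ i hi j hj]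

theorem stmt6 {n : ℕ} (hn : 0 < n) (U B : Set (Fin n → ℝ)) (hU : IsOpen U) (hBU : B ⊆ U)
    (g h : (Fin n → ℝ) → ℝ) (hg : ContDiffOn ℝ 2 g U) (hh : ContDiffOn ℝ 2 h U)
    (Lg Lh : Finset (Fin n)) (hLgp : Lg ≠ Finset.univ) (hLhp : Lh ≠ Finset.univ)
    (hcup : Lg ∪ Lh = Finset.univ)
    (hling : ∀ i ∈ Lg, ∃ c : ℝ, ∀ x ∈ U, pd g i x = c)
    (hlinh : ∀ i ∈ Lh, ∃ c : ℝ, ∀ x ∈ U, pd h i x = c)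
    (glo ghi hlo hhi : ℝ) (hgI : glo ≤ ghi) (hhI : hlo ≤ hhi)
    (hgB : ∀ x ∈ B, eigsIn (redHess g Lgᶜ x) glo ghi)
    (hhB : ∀ x ∈ B, eigsIn (redHess h Lhᶜ x) hlo hhi) :
    ∀ x ∈ B, eigsIn (redHess (fun y => g y + h y) ((Lg ∩ Lh)ᶜ) x)
      (min glo hlo) (max ghi hhi) := by
  intro x hx
  have hUx : U ∈ nhds x := hU.mem_nhds (hBU hx)
  have hgx := hg.contDiffAt hUx
  have hhx := hh.contDiffAt hUx
  have hg0 : ∀ j ∈ Lg, ∀ i, pd2 g i j x = 0 := fun j hj =>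
    pd2_eq_zero_of_pd_const hUx (hling j hj)
  have hh0 : ∀ j ∈ Lh, ∀ i, pd2 h i j x = 0 := fun j hj =>
    pd2_eq_zero_of_pd_const hUx (hlinh j hj)
  have hor : ∀ i, i ∈ Lg ∨ i ∈ Lh := fun i => by
    rw [← Finset.mem_union, hcup]; exact Finset.mem_univ i
  rw [eigsIn_redHess_iff]
  rintro μ v ⟨i, hi, hvi⟩ hv
  rw [Finset.mem_compl, Finset.mem_inter, not_and_or] at hi
  rcases hi with hi | hi
  · have := eigenvalue_bounds_of_decoupled (p := g) (J := Lgᶜ)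
      (Finset.compl_subset_compl.2 Finset.inter_subset_left)
      (fun i hi j _ => by
        rw [hgx.pd2_add hhx, hhx.pd2_comm,
          hh0 i ((hor i).resolve_left (Finset.mem_compl.1 hi)), add_zero])
      (fun i hi j _ hj => by
        rw [hgx.pd2_add hhx, hhx.pd2_comm,
          hh0 i ((hor i).resolve_left (Finset.mem_compl.1 hi)),
          hg0 j (by simpa using hj), add_zero])
      (hgB x hx) ⟨i, Finset.mem_compl.2 hi, hvi⟩ hv
    exact ⟨(min_le_left _ _).trans this.1, this.2.trans (le_max_left _ _)⟩
  · have := eigenvalue_bounds_of_decoupled (p := h) (J := Lhᶜ)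
      (Finset.compl_subset_compl.2 Finset.inter_subset_right)
      (fun i hi j _ => by
        rw [hgx.pd2_add hhx, hgx.pd2_comm,
          hg0 i ((hor i).resolve_right (Finset.mem_compl.1 hi)), zero_add])
      (fun i hi j _ hj => by
        rw [hgx.pd2_add hhx, hgx.pd2_comm,
          hg0 i ((hor i).resolve_right (Finset.mem_compl.1 hi)),
          hh0 j (by simpa using hj), add_zero])
      (hhB x hx) ⟨i, Finset.mem_compl.2 hi, hvi⟩ hv
    exact ⟨(min_le_right _ _).trans this.1, this.2.trans (le_max_right _ _)⟩
end

section
/- Let m ≥ 1 and let a, b ∈ ℝ^m satisfy a̲_i ≤ a_i ≤ ā_i and b̲_i ≤ b_i ≤ b̄_i for all i ∈ {1,…,m}, where a̲_i ≤ ā_i and b̲_i ≤ b̄_i are given reals. Set β = sqrt((Σ_{i=1}^m max{a̲_i², ā_i²})·(Σ_{i=1}^m max{b̲_i², b̄_i²})). Then every eigenvalue λ of the symmetric matrix a bᵀ + b aᵀ ∈ ℝ^{m×m} satisfies −β + Σ_{i=1}^m min{a̲_i b̲_i, a̲_i b̄_i, ā_i b̲_i, ā_i b̄_i} ≤ λ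 ≤ β + Σ_{i=1}^m max{a̲_i b̲_i, a̲_i b̄_i, ā_i b̲_i, ā_i b̄_i}. -/
open scoped BigOperators

/-- A product with one factor in an interval is at most the larger product with an endpoint. -/
lemma mul_le_max_mul_of_mem_Icc {x l u : ℝ} (c : ℝ) (hl : l ≤ x) (hu : x ≤ u) :
    x * c ≤ max (l * c) (u * c) := by
  rcases le_total 0 c with hc | hc
  · exact le_max_of_le_right (mul_le_mul_of_nonneg_right hu hc)
  · exact le_max_of_le_left (mul_le_mul_of_nonpos_right hl hc)

lemma mul_le_max_corners {x y l u l' u' : ℝ} (hl : l ≤ x) (hu : x ≤ u) (hl' : l' ≤ y)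
    (hu' : y ≤ u') :
    x * y ≤ max (max (l * l') (l * u')) (max (u * l') (u * u')) := by
  refine (mul_le_max_mul_of_mem_Icc y hl hu).trans (max_le_max ?_ ?_)
  · simpa only [mul_comm] using mul_le_max_mul_of_mem_Icc l hl' hu'
  · simpa only [mul_comm] using mul_le_max_mul_of_mem_Icc u hl' hu'

lemma min_corners_le_mul {x y l u l' u' : ℝ} (hl : l ≤ x) (hu : x ≤ u) (hl' : l' ≤ y)
    (hu' : y ≤ u') :
    min (min (l * l') (l * u')) (min (u * l') (u * u')) ≤ x * y := by
  have h := mul_le_max_corners (neg_le_neg hu) (neg_le_neg hl) hl' hu'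
  simp only [neg_mul, max_neg_neg, neg_le_neg_iff] at h
  rwa [min_comm] at h

lemma sq_le_max_sq_of_mem_Icc {x l u : ℝ} (hl : l ≤ x) (hu : x ≤ u) :
    x ^ 2 ≤ max (l ^ 2) (u ^ 2) := by
  rcases le_total 0 x with hx | hx
  · exact le_max_of_le_right (pow_le_pow_left₀ hx hu 2)
  · exact le_max_of_le_left (by nlinarith)

/-- An eigenvalue of `a bᵀ + b aᵀ` differs from `a ⬝ᵥ b` by at most `‖a‖ ‖b‖`. -/
lemma sq_eigenvalue_sub_dotProduct_le {ι : Type*} [Fintype ι] {a b v : ι → ℝ} {μ : ℝ}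
    (hv : v ≠ 0)
    (h : (Matrix.vecMulVec a b + Matrix.vecMulVec b a).mulVec v = μ • v) :
    (μ - a ⬝ᵥ b) ^ 2 ≤ (a ⬝ᵥ a) * (b ⬝ᵥ b) := by
  have hmul : (b ⬝ᵥ v) • a + (a ⬝ᵥ v) • b = μ • v := by
    rw [← h, Matrix.add_mulVec, Matrix.vecMulVec_mulVec, Matrix.vecMulVec_mulVec]
    simp
  have key (w : ι → ℝ) : (b ⬝ᵥ v) * (w ⬝ᵥ a) + (a ⬝ᵥ v) * (w ⬝ᵥ b) = μ * (w ⬝ᵥ v) := by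
    simpa [dotProduct_add] using congrArg (w ⬝ᵥ ·) hmul
  have ha := key a
  have hb := key b
  have hvv := key v
  rw [dotProduct_comm b a] at hb
  rw [dotProduct_comm v a, dotProduct_comm v b] at hvv
  by_cases hpq : (a ⬝ᵥ v) * (b ⬝ᵥ v) = 0
  · have hμ : μ = 0 := by
      have h0 : μ * (v ⬝ᵥ v) = 0 := by linarith
      exact (mul_eq_zero.mp h0).resolve_right (dotProduct_self_eq_zero.not.mpr hv)
    have hcs := Finset.sum_mul_sq_le_sq_mul_sq Finset.univ a b
    simpa [hμ, dotProduct, ← sq] using hcs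
  · refine le_of_eq (mul_right_cancel₀ hpq ?_)
    linear_combination -(μ - a ⬝ᵥ b) * (b ⬝ᵥ v) * ha - (a ⬝ᵥ a) * (b ⬝ᵥ v) * hb

theorem stmt11 {m : ℕ} (hm : 1 ≤ m) (a b la ua lb ub : Fin m → ℝ)
    (hlua : ∀ i, la i ≤ ua i) (hlub : ∀ i, lb i ≤ ub i)
    (hla : ∀ i, la i ≤ a i) (hua : ∀ i, a i ≤ ua i)
    (hlb : ∀ i, lb i ≤ b i) (hub : ∀ i, b i ≤ ub i) :
    eigsIn (Matrix.vecMulVec a b + Matrix.vecMulVec b a)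
      (-Real.sqrt ((∑ i, max ((la i) ^ 2) ((ua i) ^ 2)) *
          (∑ i, max ((lb i) ^ 2) ((ub i) ^ 2))) +
        ∑ i, min (min (la i * lb i) (la i * ub i)) (min (ua i * lb i) (ua i * ub i)))
      (Real.sqrt ((∑ i, max ((la i) ^ 2) ((ua i) ^ 2)) *
          (∑ i, max ((lb i) ^ 2) ((ub i) ^ 2))) +
        ∑ i, max (max (la i * lb i) (la i * ub i)) (max (ua i * lb i) (ua i * ub i))) := by
  intro μ v hv h
  have hβ : |μ - a ⬝ᵥ b| ≤ Real.sqrt ((∑ i, max ((la i) ^ 2) ((ua i) ^ 2)) *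
      (∑ i, max ((lb i) ^ 2) ((ub i) ^ 2))) := by
    refine Real.abs_le_sqrt ((sq_eigenvalue_sub_dotProduct_le hv h).trans ?_)
    simp only [dotProduct, ← sq]
    gcongr with i _ i _
    · exact sq_le_max_sq_of_mem_Icc (hla i) (hua i)
    · exact sq_le_max_sq_of_mem_Icc (hlb i) (hub i)
  have hlo := Finset.sum_le_sum fun i (_ : i ∈ Finset.univ) =>
    min_corners_le_mul (hla i) (hua i) (hlb i) (hub i)
  have hhi := Finset.sum_le_sum fun i (_ : i ∈ Finset.univ) =>
    mul_le_max_corners (hla i) (hua i) (hlb i) (hub i)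
  rw [abs_le, dotProduct] at hβ
  constructor <;> linarith [hβ.1, hβ.2]
end

section
/- Let [a̲, ā], [b̲, b̄], [c̲, c̄] ⊂ ℝ be real intervals (a̲ ≤ ā, b̲ ≤ b̄, c̲ ≤ c̄), set d = 4·max{c̲², c̄²}, and consider the set 𝓗 of all symmetric matrices H ∈ ℝ^{2×2} with H₁₁ ∈ [a̲, ā], H₂₂ ∈ [b̲, b̄], and H₁₂ = H₂₁ ∈ [c̲, c̄]. Then min_{H ∈ 𝓗} λ_min(H) = ½(a̲ + b̲ − sqrt((a̲ − b̲)² + d)) and max_{H ∈ 𝓗} λ_max(H) = ½(ā + b̄ + sqrt((ā − b̄)² + d)); i.e., these formulas give tight lower and upper bounds on the spectra of all matrices in 𝓗. -/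
theorem add_add_sqrt_mono {a a' b b' u v : ℝ} (ha : a ≤ a') (hb : b ≤ b')
    (hu : 0 ≤ u) (huv : u ≤ v) :
    a + b + √((a - b) ^ 2 + 4 * u) ≤ a' + b' + √((a' - b') ^ 2 + 4 * v) := by
  set S := √((a' - b') ^ 2 + 4 * v)
  have hS : S ^ 2 = (a' - b') ^ 2 + 4 * v :=
    Real.sq_sqrt (by nlinarith [sq_nonneg (a' - b')])
  have habs : |a' - b'| ≤ S := Real.abs_le_sqrt (by linarith)
  obtain ⟨h₁, h₂⟩ := abs_le.1 habs
  suffices √((a - b) ^ 2 + 4 * u) ≤ a' + b' - a - b + S by linarith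
  apply Real.sqrt_le_iff.2
  refine ⟨by linarith [abs_nonneg (a' - b')], ?_⟩
  have hDE := mul_nonneg (sub_nonneg.2 ha) (sub_nonneg.2 hb)
  have hD := mul_nonneg (sub_nonneg.2 ha) (by linarith : 0 ≤ S + (a' - b'))
  have hE := mul_nonneg (sub_nonneg.2 hb) (by linarith : 0 ≤ S - (a' - b'))
  nlinarith

theorem add_sub_sqrt_mono {a a' b b' u v : ℝ} (ha : a ≤ a') (hb : b ≤ b')
    (hu : 0 ≤ u) (huv : u ≤ v) :
    a + b - √((a - b) ^ 2 + 4 * v) ≤ a' + b' - √((a' - b') ^ 2 + 4 * u) := by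
  have h := add_add_sqrt_mono (neg_le_neg ha) (neg_le_neg hb) hu huv
  rw [show (-a' - -b') ^ 2 = (a' - b') ^ 2 by ring,
    show (-a - -b) ^ 2 = (a - b) ^ 2 by ring] at h
  linarith

namespace Matrix.IsHermitian

variable {H : Matrix (Fin 2) (Fin 2) ℝ} (hH : H.IsHermitian)

theorem eigenvalues_zero_add_eigenvalues_one :
    hH.eigenvalues 0 + hH.eigenvalues 1 = H 0 0 + H 1 1 := by
  have h := hH.trace_eq_sum_eigenvalues
  simpa [Matrix.trace_fin_two] using h.symm

theorem abs_eigenvalues_zero_sub_eigenvalues_one :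
    |hH.eigenvalues 0 - hH.eigenvalues 1| =
      √((H 0 0 - H 1 1) ^ 2 + 4 * H 0 1 ^ 2) := by
  have htr := hH.eigenvalues_zero_add_eigenvalues_one
  have hdet : H 0 0 * H 1 1 - H 0 1 * H 1 0 = hH.eigenvalues 0 * hH.eigenvalues 1 := by
    simpa [Matrix.det_fin_two] using hH.det_eq_prod_eigenvalues
  have hsymm : H 1 0 = H 0 1 := by simpa using hH.apply 0 1
  rw [hsymm] at hdet
  rw [← Real.sqrt_sq_eq_abs]
  congr 1
  linear_combination (hH.eigenvalues 0 + hH.eigenvalues 1 + H 0 0 + H 1 1) * htr + 4 * hdet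

theorem iSup_eigenvalues_fin_two :
    ⨆ k, hH.eigenvalues k =
      (H 0 0 + H 1 1 + √((H 0 0 - H 1 1) ^ 2 + 4 * H 0 1 ^ 2)) / 2 := by
  have hsup : ⨆ k, hH.eigenvalues k = max (hH.eigenvalues 0) (hH.eigenvalues 1) := by
    apply le_antisymm
    · exact ciSup_le (Fin.forall_fin_two.2 ⟨le_max_left _ _, le_max_right _ _⟩)
    · exact max_le (le_ciSup (Set.finite_range _).bddAbove 0)
        (le_ciSup (Set.finite_range _).bddAbove 1)
  have hadd := hH.eigenvalues_zero_add_eigenvalues_one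
  have hsub := hH.abs_eigenvalues_zero_sub_eigenvalues_one
  rw [hsup, ← hsub, ← hadd]
  rcases le_total (hH.eigenvalues 0) (hH.eigenvalues 1) with h | h
  · rw [max_eq_right h, abs_of_nonpos (sub_nonpos.2 h)]
    ring
  · rw [max_eq_left h, abs_of_nonneg (sub_nonneg.2 h)]
    ring

theorem iInf_eigenvalues_fin_two :
    ⨅ k, hH.eigenvalues k =
      (H 0 0 + H 1 1 - √((H 0 0 - H 1 1) ^ 2 + 4 * H 0 1 ^ 2)) / 2 := by
  have hinf : ⨅ k, hH.eigenvalues k = min (hH.eigenvalues 0) (hH.eigenvalues 1) := by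
    apply le_antisymm
    · exact le_min (ciInf_le (Set.finite_range _).bddBelow 0)
        (ciInf_le (Set.finite_range _).bddBelow 1)
    · exact le_ciInf (Fin.forall_fin_two.2 ⟨min_le_left _ _, min_le_right _ _⟩)
  have hadd := hH.eigenvalues_zero_add_eigenvalues_one
  have hsub := hH.abs_eigenvalues_zero_sub_eigenvalues_one
  rw [hinf, ← hsub, ← hadd]
  rcases le_total (hH.eigenvalues 0) (hH.eigenvalues 1) with h | h
  · rw [min_eq_left h, abs_of_nonpos (sub_nonpos.2 h)]
    ring
  · rw [min_eq_right h, abs_of_nonneg (sub_nonneg.2 h)]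
    ring

end Matrix.IsHermitian

theorem sq_le_max_sq_of_mem_Icc_s17 {lo hi c : ℝ} (hc : c ∈ Set.Icc lo hi) :
    c ^ 2 ≤ max (lo ^ 2) (hi ^ 2) := by
  rcases le_total 0 c with h | h
  · exact le_max_of_le_right (by nlinarith [hc.2])
  · exact le_max_of_le_left (by nlinarith [hc.1])

theorem exists_mem_Icc_sq_eq_max {lo hi : ℝ} (h : lo ≤ hi) :
    ∃ c ∈ Set.Icc lo hi, c ^ 2 = max (lo ^ 2) (hi ^ 2) := by
  rcases max_choice (lo ^ 2) (hi ^ 2) with hm | hm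
  · exact ⟨lo, Set.left_mem_Icc.2 h, hm.symm⟩
  · exact ⟨hi, Set.right_mem_Icc.2 h, hm.symm⟩

theorem isHermitian_symm_fin_two (a b c : ℝ) : (!![a, c; c, b] : Matrix _ _ ℝ).IsHermitian := by
  ext i j
  fin_cases i <;> fin_cases j <;> simp

theorem stmt17 (alo ahi blo bhi clo chi : ℝ)
    (ha : alo ≤ ahi) (hb : blo ≤ bhi) (hc : clo ≤ chi) :
    IsLeast {t : ℝ | ∃ (H : Matrix (Fin 2) (Fin 2) ℝ) (hH : H.IsHermitian),
        H 0 0 ∈ Set.Icc alo ahi ∧ H 1 1 ∈ Set.Icc blo bhi ∧ H 0 1 ∈ Set.Icc clo chi ∧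
        t = ⨅ k, hH.eigenvalues k}
      ((alo + blo - Real.sqrt ((alo - blo) ^ 2 + 4 * max (clo ^ 2) (chi ^ 2))) / 2) ∧
    IsGreatest {t : ℝ | ∃ (H : Matrix (Fin 2) (Fin 2) ℝ) (hH : H.IsHermitian),
        H 0 0 ∈ Set.Icc alo ahi ∧ H 1 1 ∈ Set.Icc blo bhi ∧ H 0 1 ∈ Set.Icc clo chi ∧
        t = ⨆ k, hH.eigenvalues k}
      ((ahi + bhi + Real.sqrt ((ahi - bhi) ^ 2 + 4 * max (clo ^ 2) (chi ^ 2))) / 2) := by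
  obtain ⟨c, hcmem, hcsq⟩ := exists_mem_Icc_sq_eq_max hc
  refine ⟨⟨⟨!![alo, c; c, blo], isHermitian_symm_fin_two alo blo c, ?_, ?_, ?_, ?_⟩, ?_⟩,
    ⟨⟨!![ahi, c; c, bhi], isHermitian_symm_fin_two ahi bhi c, ?_, ?_, ?_, ?_⟩, ?_⟩⟩
  · simpa using ha
  · simpa using hb
  · simpa using hcmem
  · rw [Matrix.IsHermitian.iInf_eigenvalues_fin_two]
    simp [hcsq]
  · rintro _ ⟨H, hH, h₀, h₁, h₂, rfl⟩
    rw [hH.iInf_eigenvalues_fin_two]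
    linarith [add_sub_sqrt_mono h₀.1 h₁.1 (sq_nonneg _) (sq_le_max_sq_of_mem_Icc_s17 h₂)]
  · simpa using ha
  · simpa using hb
  · simpa using hcmem
  · rw [Matrix.IsHermitian.iSup_eigenvalues_fin_two]
    simp [hcsq]
  · rintro _ ⟨H, hH, h₀, h₁, h₂, rfl⟩
    rw [hH.iSup_eigenvalues_fin_two]
    linarith [add_add_sqrt_mono h₀.2 h₁.2 (sq_nonneg _) (sq_le_max_sq_of_mem_Icc_s17 h₂)]
end
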